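/- There exists u ∈ 𝓜 such that K^h(u)(t,·) = u(t,·) ℙ-a.s. for every t ∈ ℝ, unique up to ρ-equivalence, and: (1) for every t ∈ ℝ and every x ∈ [0,∞)ᵈ, φ(t, −nT, ·)x → K(u)(t, ·) ℙ-almost surely as n → ∞; (2) for ℙ-almost every ω ∈ Ω, φ(t, s, ω)K(u)(s, ω) = K(u)(t, ω) for all s ≤ t and K(u)(r+T, ω) = K(u)(r, θ_T ω) for all r ∈ ℝ. That is, K(u) is a random periodic solution of period T of the forward stochastic flow φ, and all pull-back trajectories originating from the nonnegative orthant converge to it almost surely. -/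

import Mathlib

open MeasureTheory Filter
open scoped ENNReal Topology

theorem norm_mulVec_le_card_mul {d : ℕ} {A : Matrix (Fin d) (Fin d) ℝ} {a : ℝ} (ha : 0 ≤ a)
    (hA : ∀ i j, |A i j| ≤ a) (v : Fin d → ℝ) : ‖A.mulVec v‖ ≤ d * a * ‖v‖ := by
  refine (pi_norm_le_iff_of_nonneg (by positivity)).2 fun i => ?_
  calc ‖A.mulVec v i‖ ≤ ∑ j, ‖A i j * v j‖ := by
        rw [Matrix.mulVec_eq_sum, Finset.sum_apply]
        refine (norm_sum_le _ _).trans (le_of_eq (Finset.sum_congr rfl fun j _ => ?_))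
        simp
    _ ≤ ∑ _j : Fin d, a * ‖v‖ := Finset.sum_le_sum fun j _ => by
        rw [norm_mul]
        exact mul_le_mul (hA i j) (norm_le_pi_norm v j) (norm_nonneg _) ha
    _ = d * a * ‖v‖ := by simp [mul_assoc]

theorem norm_sub_le_of_partialDeriv_le {d : ℕ} {g : (Fin d → ℝ) → Fin d → ℝ} {L : ℝ}
    (hL : 0 ≤ L) (hg : ∀ x i, DifferentiableAt ℝ (fun z => g z i) x)
    (hgL : ∀ x, (∀ j, 0 ≤ x j) → ∀ i j, |fderiv ℝ (fun z => g z i) x (Pi.single j 1)| ≤ L)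
    {x y : Fin d → ℝ} (hx : ∀ i, 0 ≤ x i) (hy : ∀ i, 0 ≤ y i) :
    ‖g x - g y‖ ≤ L * d * ‖x - y‖ := by
  refine (pi_norm_le_iff_of_nonneg (by positivity)).2 fun i => ?_
  refine (convex_Ici (0 : Fin d → ℝ)).norm_image_sub_le_of_norm_fderiv_le (𝕜 := ℝ)
    (f := fun z => g z i) (fun z _ => hg z i) (fun z hz => ?_) hy hx
  refine ContinuousLinearMap.opNorm_le_bound _ (by positivity) fun v => ?_
  conv_lhs => rw [pi_eq_sum_univ' v, map_sum]
  calc _ ≤ ∑ j, ‖fderiv ℝ (fun z => g z i) z (v j • Pi.single j 1)‖ := by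
        refine (norm_sum_le _ _).trans (Finset.sum_le_sum fun j _ => le_of_eq ?_)
        congr 2
    _ ≤ ∑ _j : Fin d, ‖v‖ * L := Finset.sum_le_sum fun j _ => by
        rw [map_smul, norm_smul]
        exact mul_le_mul (norm_le_pi_norm v j) (hgL z hz i j) (norm_nonneg _) (norm_nonneg _)
    _ = L * d * ‖v‖ := by simp; ring

theorem lintegral_Iic_exp_neg_mul_sub {a : ℝ} (ha : 0 < a) (t : ℝ) :
    ∫⁻ r in Set.Iic t, ENNReal.ofReal (Real.exp (-a * (t - r))) = ENNReal.ofReal (1 / a) := by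
  have h1 : (fun r => Real.exp (-a * (t - r))) = fun r => Real.exp (-a * t) * Real.exp (a * r) := by
    funext r
    rw [← Real.exp_add]
    ring_nf
  rw [← ofReal_integral_eq_lintegral_ofReal _ (ae_of_all _ fun r => (Real.exp_pos _).le), h1,
    integral_const_mul, integral_exp_mul_Iic ha, ← mul_div_assoc, ← Real.exp_add]
  · simp
  · rw [h1]
    exact (integrableOn_exp_mul_Iic ha t).const_mul _

/-- A Gronwall-type estimate for a bounded function, with exponential kernel on `[s, ∞)`. -/
theorem le_exp_of_le_add_lintegral_exp {E : ℝ → ℝ≥0∞} {s lam c C B : ℝ} (hc : 0 ≤ c)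
    (hcl : c < lam) (hC : 0 ≤ C) (hB : 0 ≤ B)
    (hE : ∀ t, s ≤ t → E t ≤ ENNReal.ofReal (C * Real.exp (-lam * (t - s))) +
      ∫⁻ r in Set.Ioc s t, ENNReal.ofReal (c * Real.exp (-lam * (t - r))) * E r)
    (hEB : ∀ t, s ≤ t → E t ≤ ENNReal.ofReal B) {t : ℝ} (ht : s ≤ t) :
    E t ≤ ENNReal.ofReal
      (C * ((lam + c) / (lam - c)) * Real.exp (-((lam - c) / 2) * (t - s))) := by
  have hl : 0 < lam := hc.trans_lt hcl
  set m := (lam - c) / 2 with hm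
  set D := C * ((lam + c) / (lam - c)) with hD
  have hm0 : 0 < m := by rw [hm]; linarith
  have hlm : 0 < lam - m := by rw [hm]; linarith
  have hD0 : 0 ≤ D := mul_nonneg hC (div_nonneg (by linarith) (by linarith))
  have hCD : C + c * D * (1 / (lam - m)) = D := by
    have h1 : lam - m = (lam + c) / 2 := by rw [hm]; ring
    have h2 : lam - c ≠ 0 := by linarith
    have h3 : lam + c ≠ 0 := by linarith
    rw [h1, hD]
    field_simp
    ring
  have key : ∀ n : ℕ, ∀ t, s ≤ t →
      E t ≤ ENNReal.ofReal (D * Real.exp (-m * (t - s)) + B * (c / lam) ^ n) := by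
    intro n
    induction n with
    | zero =>
      intro t ht
      refine (hEB t ht).trans (ENNReal.ofReal_le_ofReal ?_)
      have := mul_nonneg hD0 (Real.exp_pos (-m * (t - s))).le
      simpa using this
    | succ n ih =>
      intro t ht
      have hq : 0 ≤ c / lam := by positivity
      have hint : ∫⁻ r in Set.Ioc s t, ENNReal.ofReal (c * Real.exp (-lam * (t - r))) * E r ≤
          ENNReal.ofReal (c * D * Real.exp (-m * (t - s)) * (1 / (lam - m)) +
            c * (B * (c / lam) ^ n) * (1 / lam)) := by
        calc _ ≤ ∫⁻ r in Set.Ioc s t,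
              (ENNReal.ofReal (c * D * Real.exp (-m * (t - s))) *
                ENNReal.ofReal (Real.exp (-(lam - m) * (t - r))) +
              ENNReal.ofReal (c * (B * (c / lam) ^ n)) *
                ENNReal.ofReal (Real.exp (-lam * (t - r)))) := by
              refine setLIntegral_mono' measurableSet_Ioc fun r hr => ?_
              refine (mul_le_mul_right (ih r hr.1.le) _).trans (le_of_eq ?_)
              rw [← ENNReal.ofReal_mul (by positivity), ← ENNReal.ofReal_mul (by positivity),
                ← ENNReal.ofReal_mul (by positivity),
                ← ENNReal.ofReal_add (by positivity) (by positivity)]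
              congr 1
              have : Real.exp (-lam * (t - r)) * Real.exp (-m * (r - s)) =
                  Real.exp (-m * (t - s)) * Real.exp (-(lam - m) * (t - r)) := by
                rw [← Real.exp_add, ← Real.exp_add]
                ring_nf
              linear_combination c * D * this
          _ ≤ ∫⁻ r in Set.Iic t,
              (ENNReal.ofReal (c * D * Real.exp (-m * (t - s))) *
                ENNReal.ofReal (Real.exp (-(lam - m) * (t - r))) +
              ENNReal.ofReal (c * (B * (c / lam) ^ n)) *
                ENNReal.ofReal (Real.exp (-lam * (t - r)))) :=
              lintegral_mono_set Set.Ioc_subset_Iic_self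
          _ = _ := by
              rw [lintegral_add_left (by fun_prop), lintegral_const_mul _ (by fun_prop),
                lintegral_const_mul _ (by fun_prop), lintegral_Iic_exp_neg_mul_sub hlm,
                lintegral_Iic_exp_neg_mul_sub hl, ← ENNReal.ofReal_mul (by positivity),
                ← ENNReal.ofReal_mul (by positivity),
                ← ENNReal.ofReal_add (by positivity) (by positivity)]
      refine (hE t ht).trans ((add_le_add_right hint _).trans ?_)
      rw [← ENNReal.ofReal_add (by positivity) (by positivity)]
      refine ENNReal.ofReal_le_ofReal ?_
      have h1 : Real.exp (-lam * (t - s)) ≤ Real.exp (-m * (t - s)) :=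
        Real.exp_le_exp.2 (by nlinarith)
      have h2 := mul_le_mul_of_nonneg_left h1 hC
      have h3 : c * (B * (c / lam) ^ n) * (1 / lam) = B * (c / lam) ^ (n + 1) := by
        rw [pow_succ]; field_simp
      have h4 : D * Real.exp (-m * (t - s)) = C * Real.exp (-m * (t - s)) +
          c * D * Real.exp (-m * (t - s)) * (1 / (lam - m)) := by
        linear_combination (-Real.exp (-m * (t - s))) * hCD
      linarith
  refine ge_of_tendsto' (x := atTop) (f := fun n : ℕ =>
    ENNReal.ofReal (D * Real.exp (-m * (t - s)) + B * (c / lam) ^ n)) ?_ fun n => key n t ht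
  refine ENNReal.tendsto_ofReal ?_
  have := (tendsto_pow_atTop_nhds_zero_of_lt_one (r := c / lam) (by positivity)
    ((div_lt_one hl).2 hcl)).const_mul B
  simpa using this.const_add (D * Real.exp (-m * (t - s)))

theorem measurable_uncurry_of_isStronglyProgressive {Ω β : Type*} [mΩ : MeasurableSpace Ω]
    [TopologicalSpace β] [TopologicalSpace.PseudoMetrizableSpace β] [MeasurableSpace β]
    [BorelSpace β] {𝓕 : Filtration ℝ mΩ} {f : ℝ → Ω → β} (hf : IsStronglyProgressive 𝓕 f) :
    Measurable (Function.uncurry f) := by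
  refine measurable_of_tendsto_metrizable
    (f := fun (n : ℕ) (p : ℝ × Ω) => f (min p.1 n) p.2) (fun n => ?_) ?_
  · have h1 := (hf (n : ℝ)).measurable
    have h2 : Measurable fun p : ℝ × Ω =>
        ((⟨min p.1 n, Set.mem_Iic.2 (min_le_right _ _)⟩ : Set.Iic (n : ℝ)), p.2) :=
      ((measurable_fst.min measurable_const).subtype_mk).prodMk measurable_snd
    have h3 : MeasurableSpace.prod (inferInstance : MeasurableSpace (Set.Iic (n : ℝ))) (𝓕 n) ≤
        MeasurableSpace.prod inferInstance mΩ :=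
      sup_le_sup le_rfl (MeasurableSpace.comap_mono (𝓕.le _))
    exact (h1.mono h3 le_rfl).comp h2
  · rw [tendsto_pi_nhds]
    intro p
    obtain ⟨n, hn⟩ := exists_nat_ge p.1
    refine tendsto_const_nhds.congr' ?_
    filter_upwards [eventually_ge_atTop n] with k hk
    have : p.1 ≤ k := hn.trans (by exact_mod_cast hk)
    simp [Function.uncurry, min_eq_left this]

/-- If the expectations of nonnegative random variables decay geometrically, then their sum is
almost surely finite. -/
theorem ae_tsum_ne_top_of_lintegral_le_exp {Ω : Type*} [MeasurableSpace Ω] {ℙ : Measure Ω}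
    {D : ℕ → Ω → ℝ≥0∞} (hD : ∀ n, AEMeasurable (D n) ℙ) {C m a T : ℝ} (hm : 0 < m)
    (hT : 0 < T)
    (h : ∀ n : ℕ, ∫⁻ ω, D n ω ∂ℙ ≤ ENNReal.ofReal (C * Real.exp (-m * (a + n * T)))) :
    ∀ᵐ ω ∂ℙ, ∑' n, D n ω ≠ ∞ := by
  have hsum : Summable fun n : ℕ => C * Real.exp (-m * (a + n * T)) := by
    have h1 : Summable fun n : ℕ => C * Real.exp (-m * a) * Real.exp (-m * T) ^ n :=
      (summable_geometric_of_lt_one (Real.exp_pos _).le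
        (by rw [Real.exp_lt_one_iff]; nlinarith)).mul_left _
    refine h1.congr fun n => ?_
    rw [← Real.exp_nat_mul, mul_assoc, ← Real.exp_add]
    ring_nf
  have hfin : ∫⁻ ω, ∑' n, D n ω ∂ℙ ≠ ∞ := by
    rw [lintegral_tsum hD]
    exact ne_top_of_le_ne_top hsum.tsum_ofReal_ne_top (ENNReal.tsum_le_tsum h)
  filter_upwards [ae_lt_top' (AEMeasurable.tsum hD) hfin] with ω hω using hω.ne

/-- The kernel issued at time `r` averages out against a random variable from the past of `r`. -/
theorem lintegral_kernel_mul_le {Ω : Type*} {m₁ m₂ : MeasurableSpace Ω}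
    [mΩ : MeasurableSpace Ω] {ℙ : Measure Ω}
    {τ : Ω → Ω} (hτ : MeasurePreserving τ ℙ ℙ) {ξ : Ω → ℝ} (hξ : Measurable ξ)
    (hm₁ : m₁ ≤ mΩ) (hm₂ : m₂ ≤ mΩ)
    (hindep : ProbabilityTheory.Indep m₁ m₂ ℙ) (hξad : Measurable[m₁] fun ω => ξ (τ ω))
    {S a : ℝ} (hξS : ∫⁻ ω, ENNReal.ofReal (ξ ω) ∂ℙ ≤ ENNReal.ofReal S) (ha : 0 ≤ a)
    {g : Ω → ℝ≥0∞} (hg : Measurable[m₂] g) :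
    ∫⁻ ω, ENNReal.ofReal (a * ξ (τ ω)) * g ω ∂ℙ ≤ ENNReal.ofReal (a * S) * ∫⁻ ω, g ω ∂ℙ := by
  have hm : Measurable[m₁] fun ω => ENNReal.ofReal (a * ξ (τ ω)) :=
    (hξad.const_mul _).ennreal_ofReal
  rw [ProbabilityTheory.lintegral_mul_eq_lintegral_mul_lintegral_of_independent_measurableSpace
    hm₁ hm₂ hindep hm hg]
  refine mul_le_mul_left ?_ _
  simp_rw [ENNReal.ofReal_mul ha]
  rw [lintegral_const_mul' _ _ ENNReal.ofReal_ne_top,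
    hτ.lintegral_comp (f := fun ω => ENNReal.ofReal (ξ ω)) hξ.ennreal_ofReal]
  exact mul_le_mul_right hξS _

/-- Averaging a nonnegative kernel against an adapted process, when the kernel issued at time `r`
is independent of the past up to `r`. -/
theorem lintegral_lintegral_kernel_mul_le {Ω : Type*} [mΩ : MeasurableSpace Ω] {ℙ : Measure Ω}
    [IsProbabilityMeasure ℙ] {θ : ℝ → Ω → Ω}
    (hθmeas : Measurable fun p : ℝ × Ω => θ p.1 p.2)
    (hθpres : ∀ t, MeasurePreserving (θ t) ℙ ℙ) {R : ℝ → Ω → ℝ}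
    (hRmeas : Measurable fun p : ℝ × Ω => R p.1 p.2)
    {𝓕 : Filtration ℝ mΩ} {𝓕st : ℝ → ℝ → MeasurableSpace Ω}
    (h𝓕st_le : ∀ s t : ℝ, s ≤ t → 𝓕st s t ≤ 𝓕 t)
    (hindep : ∀ s t : ℝ, s ≤ t → ProbabilityTheory.Indep (𝓕st s t) (𝓕 s) ℙ)
    (hRadapt : ∀ s t : ℝ, s ≤ t → Measurable[𝓕st s t] fun ω => R (t - s) (θ s ω))
    {S : ℝ} (hRS : ∀ t, 0 ≤ t → ∫⁻ ω, ENNReal.ofReal (R t ω) ∂ℙ ≤ ENNReal.ofReal S)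
    {w : ℝ → ℝ} (hw : Measurable w) (hw0 : ∀ t, 0 ≤ w t) {g : ℝ → Ω → ℝ≥0∞}
    (hg : Measurable (Function.uncurry g)) {t : ℝ} {A : Set ℝ} (hA : MeasurableSet A)
    (hAt : A ⊆ Set.Iic t) (hgad : ∀ r ∈ A, Measurable[𝓕 r] (g r)) :
    ∫⁻ ω, (∫⁻ r in A, ENNReal.ofReal (w (t - r) * R (t - r) (θ r ω)) * g r ω) ∂ℙ ≤
      ∫⁻ r in A, ENNReal.ofReal (w (t - r) * S) * (∫⁻ ω, g r ω ∂ℙ) := by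
  rw [lintegral_lintegral_swap]
  · refine setLIntegral_mono' hA fun r hr => ?_
    have hrt : r ≤ t := hAt hr
    exact lintegral_kernel_mul_le (hθpres r) (hRmeas.comp measurable_prodMk_left)
      ((h𝓕st_le r t hrt).trans (𝓕.le t)) (𝓕.le r) (hindep r t hrt) (hRadapt r t hrt)
      (hRS _ (sub_nonneg.2 hrt)) (hw0 _) (hgad r hr)
  · have h1 : Measurable fun p : Ω × ℝ => R (t - p.2) (θ p.2 p.1) :=
      hRmeas.comp ((measurable_const.sub measurable_snd).prodMk
        (hθmeas.comp (measurable_snd.prodMk measurable_fst)))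
    have h2 : Measurable fun p : Ω × ℝ => w (t - p.2) :=
      hw.comp (measurable_const.sub measurable_snd)
    exact (((h2.mul h1).ennreal_ofReal).mul (hg.comp measurable_swap)).aemeasurable

/-- A tempered random factor is dominated by half of the exponential decay. -/
theorem exists_integrableOn_Iic_bound_of_tempered {Ω : Type*} {θ : ℝ → Ω → Ω} {R : ℝ → Ω → ℝ}
    (hRpos : ∀ t ω, 0 ≤ t → 0 < R t ω)
    (hRtemp : ∀ γ : ℝ, 0 < γ → ∀ ω, ∃ C : ℝ, ∀ t s : ℝ, 0 ≤ s →
      Real.exp (-γ * |t|) * R s (θ t ω) ≤ C)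
    {lam : ℝ} (hlam : 0 < lam) (t : ℝ) (ω : Ω) :
    ∃ b : ℝ → ℝ, IntegrableOn b (Set.Iic t) ∧
      ∀ r ≤ t, R (t - r) (θ r ω) * Real.exp (-lam * (t - r)) ≤ b r := by
  obtain ⟨C, hC⟩ := hRtemp (lam / 2) (by linarith) ω
  have hC0 : 0 ≤ C :=
    (mul_pos (Real.exp_pos _) (hRpos 0 (θ 0 ω) le_rfl)).le.trans (hC 0 0 le_rfl)
  refine ⟨fun r => C * Real.exp (lam / 2 * |t| - lam / 2 * t) * Real.exp (lam / 2 * r),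
    (integrableOn_exp_mul_Iic (by linarith) t).const_mul _, fun r hr => ?_⟩
  have h1 := hC r (t - r) (by linarith)
  have h2 : R (t - r) (θ r ω) ≤ C * Real.exp (lam / 2 * |r|) := by
    have := mul_le_mul_of_nonneg_right h1 (Real.exp_pos (lam / 2 * |r|)).le
    have h3 : Real.exp (-(lam / 2) * |r|) * Real.exp (lam / 2 * |r|) = 1 := by
      rw [← Real.exp_add]; simp
    calc R (t - r) (θ r ω) = Real.exp (-(lam / 2) * |r|) * R (t - r) (θ r ω) *
          Real.exp (lam / 2 * |r|) := by linear_combination (-R (t - r) (θ r ω)) * h3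
      _ ≤ _ := this
  have h4 : |r| ≤ |t| + (t - r) := by
    have h5 : |t - r| = t - r := abs_of_nonneg (by linarith)
    have h6 := abs_sub_abs_le_abs_sub r t
    rw [abs_sub_comm, h5] at h6
    linarith
  calc R (t - r) (θ r ω) * Real.exp (-lam * (t - r))
      ≤ C * Real.exp (lam / 2 * |r|) * Real.exp (-lam * (t - r)) :=
        mul_le_mul_of_nonneg_right h2 (Real.exp_pos _).le
    _ = C * Real.exp (lam / 2 * |r| + -lam * (t - r)) := by rw [mul_assoc, ← Real.exp_add]
    _ ≤ C * Real.exp (lam / 2 * |t| - lam / 2 * t + lam / 2 * r) := by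
        refine mul_le_mul_of_nonneg_left (Real.exp_le_exp.2 ?_) hC0
        nlinarith
    _ = _ := by rw [Real.exp_add, ← mul_assoc]

theorem measurable_limsup_real {δ : Type*} {m : MeasurableSpace δ} {f : ℕ → δ → ℝ}
    (hf : ∀ n, Measurable (f n)) : Measurable fun x => limsup (fun n => f n x) atTop :=
  Measurable.limsup hf

/-- Main theorem: under the standing hypotheses and the small-gain condition
`L·d²·sup_{t≥0}𝔼[R(t,·)] < λ`, there is a fixed point `u ∈ 𝓜` of the gain operator
`K^h`, unique up to `ρ`-equivalence, such that (1) every pull-back trajectory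
`φ(t, −nT, ·)x` from the nonnegative orthant converges ℙ-a.s. to `K(u)(t,·)`; and
(2) ℙ-a.s., `φ(t,s,ω)K(u)(s,ω) = K(u)(t,ω)` for all `s ≤ t` and
`K(u)(r+T, ω) = K(u)(r, θ_T ω)` for all `r`, i.e. `K(u)` is a globally attracting
random periodic solution of period `T` of the forward stochastic flow `φ`. -/
theorem stmt_9 {Ω : Type*} [mΩ : MeasurableSpace Ω] (ℙ : Measure Ω)
    [IsProbabilityMeasure ℙ]
    (θ : ℝ → Ω → Ω)
    (hθmeas : Measurable fun p : ℝ × Ω => θ p.1 p.2)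
    (hθ0 : θ 0 = id) (hθadd : ∀ s t : ℝ, θ (t + s) = θ t ∘ θ s)
    (hθpres : ∀ t, MeasurePreserving (θ t) ℙ ℙ)
    (d : ℕ) (hd : 1 ≤ d) (lam : ℝ) (hlam : 0 < lam)
    (Φ : ℝ → Ω → Matrix (Fin d) (Fin d) ℝ)
    (hΦmeas : ∀ i j, Measurable fun p : ℝ × Ω => Φ p.1 p.2 i j)
    (hΦpos : ∀ t ω, 0 ≤ t → ∀ i j, 0 ≤ Φ t ω i j)
    (R : ℝ → Ω → ℝ)
    (hRmeas : Measurable fun p : ℝ × Ω => R p.1 p.2)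
    (hRpos : ∀ t ω, 0 ≤ t → 0 < R t ω)
    (hΦbound : ∀ t ω, 0 ≤ t → ∀ i j, |Φ t ω i j| ≤ R t ω * Real.exp (-lam * t))
    (hRtemp : ∀ γ : ℝ, 0 < γ → ∀ ω, ∃ C : ℝ, ∀ t s : ℝ, 0 ≤ s →
      Real.exp (-γ * |t|) * R s (θ t ω) ≤ C)
    (K : (ℝ → Ω → (Fin d → ℝ)) → ℝ → Ω → (Fin d → ℝ))
    (hK : ∀ v t ω, K v t ω = ∫ s in Set.Iic t, (Φ (t - s) (θ s ω)).mulVec (v s ω))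
    (T : ℝ) (hT : 0 < T)
    (h : ℝ → (Fin d → ℝ) → (Fin d → ℝ))
    (hhcont : Continuous fun p : ℝ × (Fin d → ℝ) => h p.1 p.2)
    (hhdiff : ∀ t x i, DifferentiableAt ℝ (fun z => h t z i) x)
    (hhpos : ∀ t x, (∀ i, 0 ≤ x i) → ∀ i, 0 ≤ h t x i)
    (N : Fin d → ℝ)
    (hhbdd : ∀ t x, (∀ j, 0 ≤ x j) → ∀ i, |h t x i| ≤ N i)
    (hhper : ∀ t x, h (t + T) x = h t x)
    (hmono : (∀ t x z, (∀ i, 0 ≤ x i) → (∀ i, x i ≤ z i) → ∀ i, h t x i ≤ h t z i) ∨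
             (∀ t x z, (∀ i, 0 ≤ x i) → (∀ i, x i ≤ z i) → ∀ i, h t z i ≤ h t x i))
    (L : ℝ) (hL0 : 0 ≤ L)
    (hLbound : ∀ t x, (∀ j, 0 ≤ x j) → ∀ i j,
      |fderiv ℝ (fun z => h t z i) x (Pi.single j 1)| ≤ L)
    (𝓕 : Filtration ℝ mΩ)
    (𝓕st : ℝ → ℝ → MeasurableSpace Ω)
    (h𝓕st_le : ∀ s t : ℝ, s ≤ t → 𝓕st s t ≤ 𝓕 t)
    (hindep : ∀ s t : ℝ, s ≤ t → ProbabilityTheory.Indep (𝓕st s t) (𝓕 s) ℙ)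
    (hRadapt : ∀ s t : ℝ, s ≤ t → Measurable[𝓕st s t] fun ω => R (t - s) (θ s ω))
    (hΦadapt : ∀ s t : ℝ, s ≤ t → ∀ i j,
      Measurable[𝓕 t] fun ω => Φ (t - s) (θ s ω) i j)
    (hΦprog : ∀ t : ℝ, ∀ i j,
      Measurable[MeasurableSpace.prod inferInstance (𝓕 t)]
        fun p : Set.Iic t × Ω => Φ (t - (p.1 : ℝ)) (θ (p.1 : ℝ) p.2) i j)
    (hRint : ∀ t : ℝ, 0 ≤ t → Integrable (R t) ℙ)
    (S : ℝ) (hS : IsLUB {y : ℝ | ∃ t : ℝ, 0 ≤ t ∧ y = ∫ ω, R t ω ∂ℙ} S)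
    (hsmall : L * (d : ℝ) ^ 2 * S < lam)
    (Mmem : (ℝ → Ω → (Fin d → ℝ)) → Prop)
    (hMmem : ∀ f, Mmem f ↔
      (ProgMeasurable 𝓕 f ∧ (∀ t ω i, 0 ≤ f t ω i ∧ f t ω i ≤ N i) ∧
        ∀ t ω, f (t + T) ω = f t (θ T ω)))
    (ρ : (ℝ → Ω → (Fin d → ℝ)) → (ℝ → Ω → (Fin d → ℝ)) → ℝ)
    (hρ : ∀ f₁ f₂, ρ f₁ f₂ = ⨆ t : ℝ, ∫ ω, (⨆ i : Fin d, |f₁ t ω i - f₂ t ω i|) ∂ℙ)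
    (φ : ℝ → ℝ → Ω → (Fin d → ℝ) → (Fin d → ℝ))
    (hφid : ∀ s ω x, φ s s ω x = x)
    (hφcocycle : ∀ s r t : ℝ, s ≤ r → r ≤ t → ∀ ω x, φ t r ω (φ r s ω x) = φ t s ω x)
    (hφcont : ∀ ω : Ω, Continuous fun p : ℝ × ℝ × (Fin d → ℝ) => φ p.1 p.2.1 ω p.2.2)
    (hφpos : ∀ (s t : ℝ) (ω : Ω) (x : Fin d → ℝ), s ≤ t → (∀ i, 0 ≤ x i) →
      ∀ i, 0 ≤ φ t s ω x i)
    (hφadapt : ∀ s t : ℝ, s ≤ t → ∀ (x : Fin d → ℝ) (i : Fin d),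
      Measurable[𝓕st s t] fun ω => φ t s ω x i)
    (hφper : ∀ (s t : ℝ) (ω : Ω) (x : Fin d → ℝ), s ≤ t →
      φ (t + T) (s + T) ω x = φ t s (θ T ω) x)
    (hφvoc : ∀ (s t : ℝ) (ω : Ω) (x : Fin d → ℝ), s ≤ t → (∀ i, 0 ≤ x i) →
      φ t s ω x = (Φ (t - s) (θ s ω)).mulVec x +
        ∫ r in s..t, (Φ (t - r) (θ r ω)).mulVec (h r (φ r s ω x))) :
    ∃ u, Mmem u ∧
      (∀ t : ℝ, ∀ᵐ ω ∂ℙ, h t (K u t ω) = u t ω) ∧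
      (∀ v, Mmem v → (∀ t : ℝ, ∀ᵐ ω ∂ℙ, h t (K v t ω) = v t ω) → ρ u v = 0) ∧
      (∀ (t : ℝ) (x : Fin d → ℝ), (∀ i, 0 ≤ x i) →
        ∀ᵐ ω ∂ℙ, Tendsto (fun n : ℕ => φ t (-(n : ℝ) * T) ω x) atTop
          (nhds (K u t ω))) ∧
      (∀ᵐ ω ∂ℙ, (∀ s t : ℝ, s ≤ t → φ t s ω (K u s ω) = K u t ω) ∧
        ∀ r : ℝ, K u (r + T) ω = K u r (θ T ω)) := by
  have hhN : ∀ t x, (∀ j, 0 ≤ x j) → ‖h t x‖ ≤ ‖N‖ := fun t x hx =>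
    (pi_norm_le_iff_of_nonneg (norm_nonneg _)).2 fun i =>
      (hhbdd t x hx i).trans ((le_abs_self _).trans (norm_le_pi_norm N i))
  have hdiffN : ∀ a b : Fin d → ℝ, (∀ i, 0 ≤ a i ∧ a i ≤ N i) → (∀ i, 0 ≤ b i ∧ b i ≤ N i) →
      ‖a - b‖ₑ ≤ ENNReal.ofReal ‖N‖ := fun a b ha hb => by
    rw [← ofReal_norm]
    refine ENNReal.ofReal_le_ofReal ((pi_norm_le_iff_of_nonneg (norm_nonneg _)).2 fun i => ?_)
    refine le_trans ?_ ((le_abs_self _).trans (norm_le_pi_norm N i))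
    rw [Pi.sub_apply, Real.norm_eq_abs, abs_le]
    constructor <;> linarith [(ha i).1, (ha i).2, (hb i).1, (hb i).2]
  have hhIcc : ∀ t x, (∀ j, 0 ≤ x j) → ∀ i, 0 ≤ h t x i ∧ h t x i ≤ N i := fun t x hx i =>
    ⟨hhpos t x hx i, (le_abs_self _).trans (hhbdd t x hx i)⟩
  have hlip : ∀ t x y, (∀ j, 0 ≤ x j) → (∀ j, 0 ≤ y j) →
      ‖h t x - h t y‖ₑ ≤ ENNReal.ofReal (L * d) * ‖x - y‖ₑ := fun t x y hx hy => by
    rw [← ofReal_norm, ← ofReal_norm, ← ENNReal.ofReal_mul (by positivity)]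
    exact ENNReal.ofReal_le_ofReal
      (norm_sub_le_of_partialDeriv_le hL0 (hhdiff t) (hLbound t) hx hy)
  have hRS : ∀ t, 0 ≤ t → ∫⁻ ω, ENNReal.ofReal (R t ω) ∂ℙ ≤ ENNReal.ofReal S := fun t ht => by
    rw [← ofReal_integral_eq_lintegral_ofReal (hRint t ht)
      (ae_of_all _ fun ω => (hRpos t ω ht).le)]
    exact ENNReal.ofReal_le_ofReal (hS.1 ⟨t, ht, rfl⟩)
  have hS0 : 0 ≤ S :=
    (integral_nonneg fun ω => (hRpos 0 ω le_rfl).le).trans (hS.1 ⟨0, le_rfl, rfl⟩)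
  obtain ⟨w, hw_def⟩ : ∃ w : ℝ → ℝ, ∀ t, w t = d * Real.exp (-lam * t) := ⟨_, fun _ => rfl⟩
  have hwm : Measurable w := by
    rw [funext hw_def]
    fun_prop
  have hw0 : ∀ t, 0 ≤ w t := fun t => by rw [hw_def]; positivity
  have hker : ∀ t r ω v, r ≤ t → ‖(Φ (t - r) (θ r ω)).mulVec v‖ₑ ≤
      ENNReal.ofReal (w (t - r) * R (t - r) (θ r ω)) * ‖v‖ₑ := fun t r ω v hr => by
    have h0 : 0 ≤ t - r := sub_nonneg.2 hr
    have hR0 := (hRpos (t - r) (θ r ω) h0).le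
    rw [← ofReal_norm, ← ofReal_norm,
      ← ENNReal.ofReal_mul (mul_nonneg (hw0 _) hR0)]
    refine ENNReal.ofReal_le_ofReal ((norm_mulVec_le_card_mul (by positivity)
      (hΦbound (t - r) (θ r ω) h0) v).trans (le_of_eq ?_))
    rw [hw_def]
    ring
  have hdom : ∀ t ω, ∃ b : ℝ → ℝ, IntegrableOn b (Set.Iic t) ∧
      ∀ r ≤ t, ∀ v, ‖(Φ (t - r) (θ r ω)).mulVec v‖ ≤ b r * ‖v‖ := fun t ω => by
    obtain ⟨b, hb, hbR⟩ := exists_integrableOn_Iic_bound_of_tempered hRpos hRtemp hlam t ω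
    refine ⟨fun r => d * b r, hb.const_mul _, fun r hr v => ?_⟩
    have h0 : 0 ≤ t - r := sub_nonneg.2 hr
    have hR0 := (hRpos (t - r) (θ r ω) h0).le
    exact norm_mulVec_le_card_mul ((by positivity : (0 : ℝ) ≤ _).trans (hbR r hr))
      (fun i j => (hΦbound (t - r) (θ r ω) h0 i j).trans (hbR r hr)) v
  have hΦvm : ∀ t ω (v : ℝ → Fin d → ℝ), Measurable v →
      Measurable fun r => (Φ (t - r) (θ r ω)).mulVec (v r) := fun t ω v hv => by
    refine measurable_pi_iff.2 fun i => ?_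
    simp only [Matrix.mulVec, dotProduct]
    refine Finset.measurable_sum _ fun j _ => Measurable.mul ?_ ((measurable_pi_apply j).comp hv)
    exact (hΦmeas i j).comp ((measurable_const.sub measurable_id).prodMk
      (hθmeas.comp (measurable_id.prodMk measurable_const)))
  have hint : ∀ t ω (v : ℝ → Fin d → ℝ), Measurable v → ∀ C, (∀ r, ‖v r‖ ≤ C) →
      IntegrableOn (fun r => (Φ (t - r) (θ r ω)).mulVec (v r)) (Set.Iic t) := by
    intro t ω v hv C hC
    obtain ⟨b, hb, hbv⟩ := hdom t ω
    refine (hb.norm.mul_const C).mono' (hΦvm t ω v hv).aestronglyMeasurable ?_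
    refine (ae_restrict_iff' measurableSet_Iic).2 (ae_of_all _ fun r hr => ?_)
    refine (hbv r hr _).trans ?_
    exact mul_le_mul (le_abs_self _) (hC r) (norm_nonneg _) (norm_nonneg _)
  -- The flow started at time `s`, frozen before `s`.
  have hclc : ∀ s ω x, Continuous fun r => φ (max r s) s ω x := fun s ω x =>
    (hφcont ω).comp (by fun_prop : Continuous fun r : ℝ => (max r s, s, x))
  have hclm : ∀ s ω x, Measurable fun r => h r (φ (max r s) s ω x) := fun s ω x =>
    (hhcont.comp (continuous_id.prodMk (hclc s ω x))).measurable
  have hcl0 : ∀ s ω x, (∀ i, 0 ≤ x i) → ∀ r i, 0 ≤ φ (max r s) s ω x i := fun s ω x hx r =>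
    hφpos s _ ω x (le_max_right _ _) hx
  have hvoc : ∀ s t ω x, s ≤ t → (∀ i, 0 ≤ x i) → φ t s ω x = (Φ (t - s) (θ s ω)).mulVec x +
      ∫ r in Set.Ioc s t, (Φ (t - r) (θ r ω)).mulVec (h r (φ (max r s) s ω x)) := by
    intro s t ω x hst hx
    rw [hφvoc s t ω x hst hx, intervalIntegral.integral_of_le hst]
    congr 1
    refine setIntegral_congr_fun measurableSet_Ioc fun r hr => ?_
    simp only [max_eq_left hr.1.le]
  have hvint : ∀ s t ω x, (∀ i, 0 ≤ x i) →
      IntegrableOn (fun r => (Φ (t - r) (θ r ω)).mulVec (h r (φ (max r s) s ω x)))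
        (Set.Iic t) := fun s t ω x hx =>
    hint t ω _ (hclm s ω x) _ fun r => hhN r _ (hcl0 s ω x hx r)
  have hpt : ∀ s t ω x, s ≤ t → (∀ i, 0 ≤ x i) → ‖φ t s ω x - φ t s ω 0‖ₑ ≤
      ENNReal.ofReal (w (t - s) * R (t - s) (θ s ω)) * ‖x‖ₑ +
      ∫⁻ r in Set.Ioc s t, ENNReal.ofReal (w (t - r) * R (t - r) (θ r ω)) *
        ‖h r (φ (max r s) s ω x) - h r (φ (max r s) s ω 0)‖ₑ := by
    intro s t ω x hst hx
    rw [hvoc s t ω x hst hx, hvoc s t ω 0 hst (fun _ => le_rfl), Matrix.mulVec_zero, zero_add,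
      add_sub_assoc, ← integral_sub
        ((hvint s t ω x hx).mono_set Set.Ioc_subset_Iic_self)
        ((hvint s t ω 0 fun _ => le_rfl).mono_set Set.Ioc_subset_Iic_self)]
    refine (enorm_add_le _ _).trans (add_le_add (hker t s ω x hst) ?_)
    refine (enorm_integral_le_lintegral_enorm _).trans ?_
    refine setLIntegral_mono' measurableSet_Ioc fun r hr => ?_
    rw [← Matrix.mulVec_sub]
    exact hker t r ω _ hr.2
  have hpt0 : ∀ s t ω, s ≤ t → ‖φ t s ω 0‖ₑ ≤ ∫⁻ r in Set.Ioc s t,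
      ENNReal.ofReal (w (t - r) * R (t - r) (θ r ω)) * ENNReal.ofReal ‖N‖ := by
    intro s t ω hst
    rw [hvoc s t ω 0 hst (fun _ => le_rfl), Matrix.mulVec_zero, zero_add]
    refine (enorm_integral_le_lintegral_enorm _).trans ?_
    refine setLIntegral_mono' measurableSet_Ioc fun r hr => (hker t r ω _ hr.2).trans ?_
    refine mul_le_mul_right ?_ _
    rw [← ofReal_norm]
    exact ENNReal.ofReal_le_ofReal (hhN r _ (hcl0 s ω 0 (fun _ => le_rfl) r))
  have hwint : ∀ t (C : ℝ≥0∞) (A : Set ℝ), A ⊆ Set.Iic t →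
      ∫⁻ r in A, ENNReal.ofReal (w (t - r) * S) * C ≤ ENNReal.ofReal (d * S / lam) * C := by
    intro t C A hA
    calc _ ≤ ∫⁻ r in Set.Iic t, ENNReal.ofReal (w (t - r) * S) * C := lintegral_mono_set hA
      _ = ∫⁻ r in Set.Iic t, ENNReal.ofReal (d * S) * C *
            ENNReal.ofReal (Real.exp (-lam * (t - r))) := by
          refine lintegral_congr fun r => ?_
          rw [hw_def, mul_right_comm, ENNReal.ofReal_mul (by positivity)]
          ring
      _ = _ := by
          rw [lintegral_const_mul _ (by fun_prop), lintegral_Iic_exp_neg_mul_sub hlam,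
            mul_right_comm, ← ENNReal.ofReal_mul (by positivity), mul_one_div]
  have hEconst : ∀ t (C : ℝ≥0∞) (A : Set ℝ), MeasurableSet A → A ⊆ Set.Iic t →
      ∫⁻ ω, (∫⁻ r in A, ENNReal.ofReal (w (t - r) * R (t - r) (θ r ω)) * C) ∂ℙ ≤
        ENNReal.ofReal (d * S / lam) * C := by
    intro t C A hAm hA
    refine (lintegral_lintegral_kernel_mul_le hθmeas hθpres hRmeas h𝓕st_le hindep hRadapt hRS
      hwm hw0 (g := fun _ _ => C) measurable_const hAm hA fun r _ => measurable_const).trans ?_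
    simpa using hwint t C A hA
  have hφY : ∀ s t (Y : Ω → Fin d → ℝ), s ≤ t → Measurable[𝓕 s] Y →
      Measurable[𝓕 t] fun ω => φ t s ω (Y ω) := by
    intro s t Y hst hY
    have h1 : Measurable[MeasurableSpace.prod inferInstance (𝓕 t)]
        (Function.uncurry fun (x : Fin d → ℝ) (ω : Ω) => φ t s ω x) :=
      @measurable_uncurry_of_continuous_of_measurable _ _ _ _ _ _ _ _ _ _ _ _ (𝓕 t) _
        (fun ω => (hφcont ω).comp (by fun_prop : Continuous fun x : Fin d → ℝ => (t, s, x)))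
        fun x => (@measurable_pi_lambda _ _ _ (𝓕st s t) _ _ (hφadapt s t hst x)).mono (h𝓕st_le s t hst) le_rfl
    exact h1.comp (Measurable.prodMk (hY.mono (𝓕.mono hst) le_rfl) measurable_id)
  have hφYj : ∀ s (Y : Ω → Fin d → ℝ), Measurable[𝓕 s] Y →
      Measurable (Function.uncurry fun r ω => φ (max r s) s ω (Y ω)) := fun s Y hY =>
    measurable_uncurry_of_continuous_of_measurable (fun ω => hclc s ω (Y ω)) fun r =>
      (hφY s _ Y (le_max_right _ _) hY).mono (𝓕.le _) le_rfl
  set c := L * (d : ℝ) ^ 2 * S with hc_def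
  have hc0 : 0 ≤ c := by positivity
  -- Two trajectories contract in mean.
  have hcontr : ∀ s (Y : Ω → Fin d → ℝ) (b : ℝ), 0 ≤ b → Measurable[𝓕 s] Y →
      (∀ ω i, 0 ≤ Y ω i) → ∫⁻ ω, ‖Y ω‖ₑ ∂ℙ ≤ ENNReal.ofReal b → ∀ t, s ≤ t →
      ∫⁻ ω, ‖φ t s ω (Y ω) - φ t s ω 0‖ₑ ∂ℙ ≤ ENNReal.ofReal
        (d * S * b * ((lam + c) / (lam - c)) * Real.exp (-((lam - c) / 2) * (t - s))) := by
    intro s Y b hb hY hY0 hYb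
    have hfirst : ∀ t, s ≤ t →
        ∫⁻ ω, ENNReal.ofReal (w (t - s) * R (t - s) (θ s ω)) * ‖Y ω‖ₑ ∂ℙ ≤
          ENNReal.ofReal (d * S * b * Real.exp (-lam * (t - s))) := by
      intro t hst
      refine (lintegral_kernel_mul_le (hθpres s) (hRmeas.comp measurable_prodMk_left)
        ((h𝓕st_le s t hst).trans (𝓕.le t)) (𝓕.le s) (hindep s t hst) (hRadapt s t hst)
        (hRS _ (sub_nonneg.2 hst)) (hw0 _) (measurable_enorm.comp hY)).trans ?_
      refine (mul_le_mul_right hYb _).trans (le_of_eq ?_)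
      rw [← ENNReal.ofReal_mul (mul_nonneg (hw0 _) hS0), hw_def]
      congr 1
      ring
    have hE : ∀ t, s ≤ t → ∀ g : ℝ → Ω → ℝ≥0∞, (∀ r ω, s ≤ r →
        ‖h r (φ (max r s) s ω (Y ω)) - h r (φ (max r s) s ω 0)‖ₑ ≤ g r ω) →
        ∫⁻ ω, ‖φ t s ω (Y ω) - φ t s ω 0‖ₑ ∂ℙ ≤
          ENNReal.ofReal (d * S * b * Real.exp (-lam * (t - s))) +
          ∫⁻ ω, (∫⁻ r in Set.Ioc s t,
            ENNReal.ofReal (w (t - r) * R (t - r) (θ r ω)) * g r ω) ∂ℙ := by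
      intro t hst g hg
      refine le_trans ?_ (add_le_add_left (hfirst t hst) _)
      rw [← lintegral_add_left]
      · refine lintegral_mono fun ω => (hpt s t ω (Y ω) hst (hY0 ω)).trans ?_
        refine add_le_add_right (setLIntegral_mono' measurableSet_Ioc fun r hr => ?_) _
        exact mul_le_mul_right (hg r ω hr.1.le) _
      · have h1 : Measurable fun ω => R (t - s) (θ s ω) :=
          (hRadapt s t hst).mono ((h𝓕st_le s t hst).trans (𝓕.le t)) le_rfl
        exact (h1.const_mul _).ennreal_ofReal.mul ((hY.mono (𝓕.le s) le_rfl).enorm)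
    intro t hst
    refine le_exp_of_le_add_lintegral_exp (E := fun t => ∫⁻ ω, ‖φ t s ω (Y ω) - φ t s ω 0‖ₑ ∂ℙ)
      (C := d * S * b) (B := d * S * b + d * S / lam * ‖N‖) hc0 hsmall
      (by positivity) (by positivity) (fun t hst => ?_) (fun t hst => ?_) hst
    · refine (hE t hst (fun r ω => ENNReal.ofReal (L * d) *
        ‖φ (max r s) s ω (Y ω) - φ (max r s) s ω 0‖ₑ) fun r ω _ =>
          hlip r _ _ (hcl0 s ω _ (hY0 ω) r) (hcl0 s ω 0 (fun _ => le_rfl) r)).trans ?_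
      refine add_le_add_right ?_ _
      refine (lintegral_lintegral_kernel_mul_le hθmeas hθpres hRmeas h𝓕st_le hindep hRadapt hRS
        hwm hw0 ?_ measurableSet_Ioc Set.Ioc_subset_Iic_self fun r hr => ?_).trans ?_
      · exact (((hφYj s Y hY).sub (hφYj s (fun _ => 0) measurable_const)).enorm).const_mul _
      · rw [max_eq_left hr.1.le]
        exact (measurable_enorm.comp ((hφY s r Y hr.1.le hY).sub
          (hφY s r (fun _ => 0) hr.1.le measurable_const))).const_mul _
      · refine setLIntegral_mono' measurableSet_Ioc fun r hr => ?_
        rw [lintegral_const_mul' _ _ ENNReal.ofReal_ne_top, max_eq_left hr.1.le, ← mul_assoc,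
          ← ENNReal.ofReal_mul (mul_nonneg (hw0 _) hS0)]
        refine le_of_eq ?_
        rw [hw_def, hc_def]
        congr 2
        ring
    · refine (hE t hst (fun _ _ => ENNReal.ofReal ‖N‖) fun r ω _ => hdiffN _ _
        (hhIcc r _ (hcl0 s ω _ (hY0 ω) r)) (hhIcc r _ (hcl0 s ω 0 (fun _ => le_rfl) r))).trans ?_
      rw [ENNReal.ofReal_add (by positivity) (by positivity),
        ENNReal.ofReal_mul (q := ‖N‖) (by positivity)]
      refine add_le_add (ENNReal.ofReal_le_ofReal ?_)
        (hEconst t _ _ measurableSet_Ioc Set.Ioc_subset_Iic_self)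
      refine mul_le_of_le_one_right (by positivity) (Real.exp_le_one_iff.2 ?_)
      nlinarith
  have hm0 : 0 < (lam - c) / 2 := by linarith
  have hφmeas : ∀ s t (Y : Ω → Fin d → ℝ), s ≤ t → Measurable[𝓕 s] Y →
      Measurable fun ω => φ t s ω (Y ω) := fun s t Y hst hY =>
    (hφY s t Y hst hY).mono (𝓕.le t) le_rfl
  have hstart : ∀ t : ℝ, ∃ k : ℕ, ∀ n : ℕ, -((n + k : ℕ) : ℝ) * T ≤ t := fun t => by
    obtain ⟨k, hk⟩ := exists_nat_ge (-t / T)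
    refine ⟨k, fun n => ?_⟩
    rw [div_le_iff₀ hT] at hk
    push_cast
    nlinarith [mul_nonneg n.cast_nonneg hT.le]
  have hEzero : ∀ s t, s ≤ t →
      ∫⁻ ω, ‖φ t s ω 0‖ₑ ∂ℙ ≤ ENNReal.ofReal (d * S / lam * ‖N‖) := fun s t hst => by
    rw [ENNReal.ofReal_mul (by positivity)]
    exact (lintegral_mono fun ω => hpt0 s t ω hst).trans
      (hEconst t _ _ measurableSet_Ioc Set.Ioc_subset_Iic_self)
  have hconv : ∀ t, ∀ᵐ ω ∂ℙ, ∃ l, Tendsto (fun n : ℕ => φ t (-(n : ℝ) * T) ω 0) atTop (𝓝 l) := by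
    intro t
    obtain ⟨k, hk⟩ := hstart t
    have hback : ∀ n : ℕ, -((n + 1 + k : ℕ) : ℝ) * T ≤ -((n + k : ℕ) : ℝ) * T := fun n => by
      push_cast
      nlinarith
    have hae := ae_tsum_ne_top_of_lintegral_le_exp (ℙ := ℙ)
      (D := fun n ω => ‖φ t (-((n + k : ℕ) : ℝ) * T) ω
        (φ (-((n + k : ℕ) : ℝ) * T) (-((n + 1 + k : ℕ) : ℝ) * T) ω 0) -
          φ t (-((n + k : ℕ) : ℝ) * T) ω 0‖ₑ)
      (C := d * S * (d * S / lam * ‖N‖) * ((lam + c) / (lam - c))) (a := t + k * T)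
      (fun n => (((hφmeas _ t _ (hk n) (hφY _ _ (fun _ => 0) (hback n) measurable_const)).sub
        (hφmeas _ t (fun _ => 0) (hk n) measurable_const)).enorm).aemeasurable) hm0 hT
      (fun n => by
        refine (hcontr _ _ _ (by positivity) (hφY _ _ (fun _ => 0) (hback n) measurable_const)
          (fun ω => hφpos _ _ ω 0 (hback n) fun _ => le_rfl) (hEzero _ _ (hback n)) t
          (hk n)).trans (le_of_eq ?_)
        congr 3
        push_cast
        ring)
    filter_upwards [hae] with ω hω
    have hcau : CauchySeq fun n : ℕ => φ t (-((n + k : ℕ) : ℝ) * T) ω 0 := by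
      refine cauchySeq_of_edist_le_of_tsum_ne_top _ (fun n => ?_) hω
      rw [edist_comm, edist_eq_enorm_sub, hφcocycle _ _ _ (hback n) (hk n)]
    obtain ⟨l, hl⟩ := cauchySeq_tendsto_of_complete hcau
    exact ⟨l, (tendsto_add_atTop_iff_nat (f := fun n : ℕ => φ t (-(n : ℝ) * T) ω 0) k).1 hl⟩
  -- Convergence at negative integer times propagates forward along the flow.
  have hall : ∀ᵐ ω ∂ℙ, ∀ t, ∃ l, Tendsto (fun n : ℕ => φ t (-(n : ℝ) * T) ω 0) atTop (𝓝 l) := by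
    filter_upwards [ae_all_iff.2 fun k : ℕ => hconv (-(k : ℝ))] with ω hω t
    obtain ⟨k, hk⟩ := exists_nat_ge (-t)
    obtain ⟨l, hl⟩ := hω k
    refine ⟨φ t (-(k : ℝ)) ω l, ?_⟩
    have hc : Continuous fun x => φ t (-(k : ℝ)) ω x :=
      (hφcont ω).comp (by fun_prop : Continuous fun x : Fin d → ℝ => (t, -(k : ℝ), x))
    refine ((hc.tendsto l).comp hl).congr' ?_
    obtain ⟨j, hj⟩ := hstart (-(k : ℝ))
    filter_upwards [eventually_ge_atTop j] with n hn
    obtain ⟨i, rfl⟩ := Nat.exists_eq_add_of_le' hn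
    exact hφcocycle _ _ _ (hj i) (by linarith) ω 0
  obtain ⟨y, hy⟩ : ∃ y : ℕ → ℝ → Ω → Fin d → ℝ,
      ∀ n t ω, y n t ω = φ (max t (-(n : ℝ) * T)) (-(n : ℝ) * T) ω 0 := ⟨_, fun _ _ _ => rfl⟩
  have hy0 : ∀ n t ω i, 0 ≤ y n t ω i := fun n t ω i => by
    rw [hy]
    exact hcl0 _ ω 0 (fun _ => le_rfl) t i
  have hyev : ∀ t, ∀ᶠ n : ℕ in atTop, -(n : ℝ) * T ≤ t := fun t => by
    obtain ⟨j, hj⟩ := hstart t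
    filter_upwards [eventually_ge_atTop j] with n hn
    obtain ⟨i, rfl⟩ := Nat.exists_eq_add_of_le' hn
    exact hj i
  have hyc : ∀ n ω, Continuous fun t => h t (y n t ω) := fun n ω => by
    simp only [hy]
    exact hhcont.comp (continuous_id.prodMk (hclc _ ω 0))
  have hyprog : ∀ n, IsStronglyProgressive 𝓕 fun t ω => h t (y n t ω) := fun n => by
    refine StronglyAdapted.isStronglyProgressive_of_continuous (fun t => ?_) (hyc n)
    have hyt : Measurable[𝓕 t] fun ω => y n t ω := by
      simp only [hy]
      rcases le_total (-(n : ℝ) * T) t with hn | hn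
      · rw [max_eq_left hn]
        exact hφY _ _ (fun _ => 0) hn measurable_const
      · simp only [max_eq_right hn, hφid]
        exact measurable_const
    have hht : Continuous (h t) := hhcont.comp (by fun_prop : Continuous fun x => (t, x))
    exact (hht.measurable.comp hyt).stronglyMeasurable
  have hbdd : ∀ t ω i, (atTop : Filter ℕ).IsBoundedUnder (· ≤ ·) fun n => h t (y n t ω) i :=
    fun t ω i => isBoundedUnder_of ⟨N i, fun n => (hhIcc t _ (hy0 n t ω) i).2⟩
  have hcobdd : ∀ t ω i, (atTop : Filter ℕ).IsCoboundedUnder (· ≤ ·) fun n => h t (y n t ω) i :=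
    fun t ω i => IsBoundedUnder.isCoboundedUnder_le
      (isBoundedUnder_of ⟨0, fun n => (hhIcc t _ (hy0 n t ω) i).1⟩)
  obtain ⟨u, hu⟩ : ∃ u : ℝ → Ω → Fin d → ℝ,
      ∀ t ω i, u t ω i = limsup (fun n => h t (y n t ω) i) atTop := ⟨_, fun _ _ _ => rfl⟩
  have huprog : IsStronglyProgressive 𝓕 u := fun t => by
    refine @Measurable.stronglyMeasurable _ _ (_) _ _ _ _ _ _
      (@measurable_pi_lambda _ _ _ (_) _ _ fun i => ?_)
    simp only [hu]
    refine @measurable_limsup_real _ (_) _ fun n => ?_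
    exact (measurable_pi_apply i).comp (hyprog n t).measurable
  have huIcc : ∀ t ω i, 0 ≤ u t ω i ∧ u t ω i ≤ N i := fun t ω i => by
    rw [hu]
    exact ⟨le_limsup_of_frequently_le (Frequently.of_forall fun n => (hhIcc t _ (hy0 n t ω) i).1)
        (hbdd t ω i),
      limsup_le_of_le (hcobdd t ω i) (Eventually.of_forall fun n => (hhIcc t _ (hy0 n t ω) i).2)⟩
  have huper : ∀ t ω, u (t + T) ω = u t (θ T ω) := fun t ω => by
    funext i
    rw [hu, hu, ← limsup_nat_add (fun n => h t (y n t (θ T ω)) i) 1]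
    refine congrArg (limsup · atTop) (funext fun n => ?_)
    have h1 : -(n : ℝ) * T = -((n + 1 : ℕ) : ℝ) * T + T := by push_cast; ring
    rw [hhper, hy, hy, h1, max_add_add_right, hφper _ _ _ _ (le_max_right _ _)]
  have hMu : Mmem u := (hMmem u).2 ⟨huprog, huIcc, huper⟩
  have hslice : ∀ f, Mmem f → Measurable (Function.uncurry f) ∧
      ∀ t ω, IntegrableOn (fun r => (Φ (t - r) (θ r ω)).mulVec (f r ω)) (Set.Iic t) := by
    intro f hf
    obtain ⟨hfprog, hfIcc, -⟩ := (hMmem f).1 hf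
    have hfm := measurable_uncurry_of_isStronglyProgressive hfprog
    refine ⟨hfm, fun t ω => hint t ω (fun r => f r ω) (hfm.comp measurable_prodMk_right) ‖N‖
      fun r => (pi_norm_le_iff_of_nonneg (norm_nonneg _)).2 fun i => ?_⟩
    rw [Real.norm_eq_abs, abs_of_nonneg (hfIcc r ω i).1]
    exact (hfIcc r ω i).2.trans ((le_abs_self _).trans (norm_le_pi_norm N i))
  -- The pull-back limit is `K u`, and `u` is the corresponding input.
  have hgood : ∀ᵐ ω ∂ℙ, ∀ t,
      Tendsto (fun n : ℕ => φ t (-(n : ℝ) * T) ω 0) atTop (𝓝 (K u t ω)) ∧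
        h t (K u t ω) = u t ω := by
    filter_upwards [hall] with ω hω
    choose z hz using hω
    have hyz : ∀ t, Tendsto (fun n => y n t ω) atTop (𝓝 (z t)) := fun t => by
      refine (hz t).congr' ?_
      filter_upwards [hyev t] with n hn
      rw [hy, max_eq_left hn]
    have hhz : ∀ t, Tendsto (fun n => h t (y n t ω)) atTop (𝓝 (h t (z t))) := fun t =>
      ((hhcont.comp (by fun_prop : Continuous fun x => (t, x))).tendsto (z t)).comp (hyz t)
    have huz : ∀ t, u t ω = h t (z t) := fun t => by
      funext i
      rw [hu]
      exact ((tendsto_pi_nhds.1 (hhz t)) i).limsup_eq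
    have hKz : ∀ t, K u t ω = z t := by
      intro t
      obtain ⟨b, hb, hbv⟩ := hdom t ω
      have hlim : Tendsto (fun n : ℕ => ∫ r in Set.Iic t, (Set.Ioi (-(n : ℝ) * T)).indicator
          (fun r => (Φ (t - r) (θ r ω)).mulVec (h r (y n r ω))) r) atTop
          (𝓝 (∫ r in Set.Iic t, (Φ (t - r) (θ r ω)).mulVec (u r ω))) := by
        refine tendsto_integral_of_dominated_convergence (fun r => ‖b r‖ * ‖N‖) (fun n => ?_)
          (hb.norm.mul_const _) (fun n => ?_) ?_
        · exact ((hΦvm t ω _ (hyc n ω).measurable).indicator measurableSet_Ioi).aestronglyMeasurable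
        · refine (ae_restrict_iff' measurableSet_Iic).2 (ae_of_all _ fun r hr => ?_)
          refine (norm_indicator_le_norm_self _ _).trans ((hbv r hr _).trans ?_)
          exact mul_le_mul (le_abs_self _) (hhN r _ (hy0 n r ω)) (norm_nonneg _) (norm_nonneg _)
        · refine ae_of_all _ fun r => ?_
          rw [huz r]
          have hc : Continuous fun v => (Φ (t - r) (θ r ω)).mulVec v := by fun_prop
          refine ((hc.tendsto _).comp (hhz r)).congr' ?_
          filter_upwards [hyev (r - 1)] with n hn
          rw [Set.indicator_of_mem (Set.mem_Ioi.2 (by linarith))]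
          rfl
      rw [hK]
      refine tendsto_nhds_unique (hlim.congr' ?_) (hz t)
      filter_upwards [hyev t] with n hn
      rw [setIntegral_indicator measurableSet_Ioi, Set.inter_comm, Set.Ioi_inter_Iic,
        hvoc _ t ω 0 hn (fun _ => le_rfl), Matrix.mulVec_zero, zero_add]
      simp only [hy]
    intro t
    rw [hKz t, huz t]
    exact ⟨hz t, rfl⟩
  refine ⟨u, hMu, fun t => hgood.mono fun ω hω => (hω t).2, ?_, ?_, ?_⟩
  · intro v hMv hv
    obtain ⟨hvprog, hvIcc, -⟩ := (hMmem v).1 hMv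
    obtain ⟨hum, huint⟩ := hslice u hMu
    obtain ⟨hvm, hvint'⟩ := hslice v hMv
    have hKpos : ∀ f, Mmem f → ∀ t ω i, 0 ≤ K f t ω i := fun f hf t ω i => by
      rw [hK, eval_integral fun i => ((hslice f hf).2 t ω).eval i]
      refine setIntegral_nonneg measurableSet_Iic fun r hr => ?_
      simp only [Matrix.mulVec, dotProduct]
      exact Finset.sum_nonneg fun j _ => mul_nonneg
        (hΦpos _ _ (sub_nonneg.2 hr) i j) (((hMmem f).1 hf).2.1 r ω j).1
    have hiter : ∀ n : ℕ, ∀ t, ∫⁻ ω, ‖u t ω - v t ω‖ₑ ∂ℙ ≤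
        ENNReal.ofReal (‖N‖ * (c / lam) ^ n) := by
      intro n
      induction n with
      | zero =>
        intro t
        refine (lintegral_mono fun ω => hdiffN _ _ (huIcc t ω) (hvIcc t ω)).trans ?_
        simp
      | succ n ih =>
        intro t
        calc ∫⁻ ω, ‖u t ω - v t ω‖ₑ ∂ℙ
            ≤ ∫⁻ ω, (∫⁻ r in Set.Iic t, ENNReal.ofReal (w (t - r) * R (t - r) (θ r ω)) *
                (ENNReal.ofReal (L * d) * ‖u r ω - v r ω‖ₑ)) ∂ℙ := by
              refine lintegral_mono_ae ?_
              filter_upwards [hgood, hv t] with ω hω hvω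
              rw [← (hω t).2, ← hvω]
              refine (hlip t _ _ (hKpos u hMu t ω) (hKpos v hMv t ω)).trans ?_
              simp_rw [mul_left_comm _ (ENNReal.ofReal (L * d))]
              rw [lintegral_const_mul' _ _ ENNReal.ofReal_ne_top]
              refine mul_le_mul_right ?_ _
              rw [hK, hK, ← integral_sub (huint t ω) (hvint' t ω)]
              refine (enorm_integral_le_lintegral_enorm _).trans ?_
              refine setLIntegral_mono' measurableSet_Iic fun r hr => ?_
              rw [← Matrix.mulVec_sub]
              exact hker t r ω _ hr
          _ ≤ ∫⁻ r in Set.Iic t, ENNReal.ofReal (w (t - r) * S) *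
                (∫⁻ ω, ENNReal.ofReal (L * d) * ‖u r ω - v r ω‖ₑ ∂ℙ) := by
              refine lintegral_lintegral_kernel_mul_le hθmeas hθpres hRmeas h𝓕st_le hindep
                hRadapt hRS hwm hw0 ((hum.sub hvm).enorm.const_mul _) measurableSet_Iic le_rfl
                fun r _ => ?_
              exact (measurable_enorm.comp ((huprog.stronglyAdapted r).measurable.sub
                (IsStronglyProgressive.stronglyAdapted hvprog r).measurable)).const_mul _
          _ ≤ ∫⁻ r in Set.Iic t, ENNReal.ofReal (w (t - r) * S) *
                ENNReal.ofReal (L * d * (‖N‖ * (c / lam) ^ n)) := by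
              refine lintegral_mono fun r => mul_le_mul_right ?_ _
              rw [lintegral_const_mul' _ _ ENNReal.ofReal_ne_top,
                ENNReal.ofReal_mul (p := L * d) (q := ‖N‖ * (c / lam) ^ n) (by positivity)]
              exact mul_le_mul_right (ih r) _
          _ ≤ _ := hwint t _ _ le_rfl
          _ = _ := by
              rw [← ENNReal.ofReal_mul (by positivity), pow_succ]
              congr 1
              rw [hc_def]
              ring
    have hzero : ∀ t, ∫⁻ ω, ‖u t ω - v t ω‖ₑ ∂ℙ = 0 := fun t => by
      refine le_antisymm (ge_of_tendsto' (x := atTop) ?_ fun n => hiter n t) zero_le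
      have := (tendsto_pow_atTop_nhds_zero_of_lt_one (r := c / lam) (by positivity)
        ((div_lt_one hlam).2 hsmall)).const_mul ‖N‖
      simpa using ENNReal.tendsto_ofReal this
    have hEρ : ∀ t, ∫ ω, (⨆ i : Fin d, |u t ω i - v t ω i|) ∂ℙ = 0 := fun t => by
      have hae := (lintegral_eq_zero_iff
        (((hum.comp measurable_prodMk_left).sub (hvm.comp measurable_prodMk_left)).enorm :
          Measurable fun ω => ‖u t ω - v t ω‖ₑ)).1 (hzero t)
      refine integral_eq_zero_of_ae (hae.mono fun ω hω => ?_)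
      have huv : u t ω = v t ω := sub_eq_zero.1 (enorm_eq_zero.1 hω)
      simp [huv]
    simp [hρ, hEρ]
  · intro t x hx
    obtain ⟨k, hk⟩ := hstart t
    have hae := ae_tsum_ne_top_of_lintegral_le_exp (ℙ := ℙ)
      (D := fun n ω => ‖φ t (-((n + k : ℕ) : ℝ) * T) ω x - φ t (-((n + k : ℕ) : ℝ) * T) ω 0‖ₑ)
      (C := d * S * ‖x‖ * ((lam + c) / (lam - c))) (a := t + k * T)
      (fun n => (((hφmeas _ t (fun _ => x) (hk n) measurable_const).sub
        (hφmeas _ t (fun _ => 0) (hk n) measurable_const)).enorm).aemeasurable) hm0 hT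
      (fun n => by
        refine (hcontr _ (fun _ => x) ‖x‖ (norm_nonneg _) measurable_const (fun _ => hx)
          (by simp) t (hk n)).trans (le_of_eq ?_)
        congr 3
        push_cast
        ring)
    filter_upwards [hae, hgood] with ω hω hgω
    have h1 := ENNReal.tendsto_atTop_zero_of_tsum_ne_top hω
    have h2 : Tendsto (fun n : ℕ => φ t (-(n : ℝ) * T) ω x - φ t (-(n : ℝ) * T) ω 0) atTop
        (𝓝 0) := by
      refine (tendsto_add_atTop_iff_nat k).1 (tendsto_iff_edist_tendsto_0.2 ?_)
      simpa only [edist_zero_right] using h1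
    simpa using h2.add (hgω t).1
  · filter_upwards [hgood] with ω hω
    refine ⟨fun s t hst => ?_, fun r => ?_⟩
    · have hc : Continuous fun x => φ t s ω x :=
        (hφcont ω).comp (by fun_prop : Continuous fun x : Fin d → ℝ => (t, s, x))
      refine tendsto_nhds_unique (((hc.tendsto _).comp (hω s).1).congr' ?_) (hω t).1
      filter_upwards [hyev s] with n hn
      exact hφcocycle _ _ _ hn hst ω 0
    · rw [hK, hK, ← (measurePreserving_add_right volume T).setIntegral_preimage_emb
        (measurableEmbedding_addRight T)]
      have hpre : (fun s : ℝ => s + T) ⁻¹' Set.Iic (r + T) = Set.Iic r := by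
        ext s
        simp
      rw [hpre]
      refine setIntegral_congr_fun measurableSet_Iic fun s _ => ?_
      simp only [huper, hθadd, Function.comp_apply, add_sub_add_right_eq_sub]
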